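/- Let 0<α<n, 1<p<n/α, 1/q=1/p−α/n, 0<κ<p/q, and w∈A_{p,q}. Let K be a measurable kernel with |K(x,y)| ≤ C_K|x−y|^{α−n} for x≠y, and let b∈BMO(ℝⁿ). For a ball B define, for x∈B, H(x) = |b(x)−b_B|·∫_{ℝⁿ∖2B}|K(x,y)|·|f(y)|dy. Then there is a constant C (independent of B and f) such that w^q(B)^{−κ/p}(∫_B H(x)^q w^q(x)dx)^{1/q} ≤ C‖b‖_*‖f‖_{L^{p,κ}(w^p,w^q)}. -/

import Mathlib

open MeasureTheory Metric Set
open scoped ENNReal NNReal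

noncomputable section

/-- Euclidean space ℝⁿ. -/
abbrev Rn (n : ℕ) := EuclideanSpace ℝ (Fin n)

variable {n : ℕ}

/-- A weight: a nonnegative locally integrable function on ℝⁿ. -/
def IsWeight (w : Rn n → ℝ) : Prop :=
  (∀ x, 0 ≤ w x) ∧ LocallyIntegrable w volume

/-- Weighted measure of a set: `v(E) = ∫_E v`. -/
def wMeas (v : Rn n → ℝ) (E : Set (Rn n)) : ℝ≥0∞ :=
  ∫⁻ x in E, ENNReal.ofReal (v x)

/-- Average of `b` over a set: `b_E = |E|⁻¹ ∫_E b`. -/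
def avg (b : Rn n → ℝ) (E : Set (Rn n)) : ℝ :=
  ⨍ y in E, b y

/-- BMO seminorm ‖b‖_*. -/
def bmoNorm (b : Rn n → ℝ) : ℝ≥0∞ :=
  ⨆ (x : Rn n) (r : ℝ) (_ : 0 < r),
    (volume (ball x r))⁻¹ *
      ∫⁻ y in ball x r, ENNReal.ofReal |b y - avg b (ball x r)|

/-- `b ∈ BMO(ℝⁿ)`. -/
def IsBMO (b : Rn n → ℝ) : Prop :=
  LocallyIntegrable b volume ∧ bmoNorm b ≠ ∞

/-- Homogeneous Lipschitz seminorm of order β. -/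
def lipNorm (β : ℝ) (b : Rn n → ℝ) : ℝ≥0∞ :=
  ⨆ (x : Rn n) (h : Rn n) (_ : h ≠ 0),
    ENNReal.ofReal (|b (x + h) - b x| / ‖h‖ ^ β)

/-- Two-weight weighted Morrey norm ‖f‖_{L^{p,κ}(u,v)}. -/
def morreyNorm (p κ : ℝ) (u v : Rn n → ℝ) (f : Rn n → ℝ) : ℝ≥0∞ :=
  ⨆ (x : Rn n) (r : ℝ) (_ : 0 < r),
    ((wMeas v (ball x r)) ^ (-κ) *
      (∫⁻ y in ball x r, ENNReal.ofReal |f y| ^ p * ENNReal.ofReal (u y))) ^ (1 / p)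

/-- Weighted weak Morrey norm ‖f‖_{WL^{p,κ}(v)}. -/
def weakMorreyNorm (p κ : ℝ) (v : Rn n → ℝ) (f : Rn n → ℝ) : ℝ≥0∞ :=
  ⨆ (x : Rn n) (r : ℝ) (_ : 0 < r) (t : ℝ) (_ : 0 < t),
    (wMeas v (ball x r)) ^ (-(κ / p)) * ENNReal.ofReal t *
      (wMeas v {y ∈ ball x r | t < |f y|}) ^ (1 / p)

/-- Weighted Lᵖ norm ‖f‖_{L^p(v)}. -/
def wLpNorm (p : ℝ) (v : Rn n → ℝ) (f : Rn n → ℝ) : ℝ≥0∞ :=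
  (∫⁻ x, ENNReal.ofReal |f x| ^ p * ENNReal.ofReal (v x)) ^ (1 / p)

/-- Muckenhoupt class A_{p,q} for 1 < p ≤ q < ∞. -/
def IsApq (p q : ℝ) (w : Rn n → ℝ) : Prop :=
  ∃ C : ℝ≥0, ∀ (x : Rn n) (r : ℝ), 0 < r →
    ((volume (ball x r))⁻¹ * (∫⁻ y in ball x r, ENNReal.ofReal (w y) ^ q)) ^ (1 / q) *
      ((volume (ball x r))⁻¹ *
        (∫⁻ y in ball x r, ENNReal.ofReal (w y) ^ (-(p / (p - 1))))) ^ (1 - 1 / p) ≤ C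

/-- Muckenhoupt class A_{1,q} for 1 < q < ∞. -/
def IsA1q (q : ℝ) (w : Rn n → ℝ) : Prop :=
  ∃ C : ℝ≥0, ∀ (x : Rn n) (r : ℝ), 0 < r →
    ((volume (ball x r))⁻¹ * (∫⁻ y in ball x r, ENNReal.ofReal (w y) ^ q)) ^ (1 / q) ≤
      C * essInf (fun y => ENNReal.ofReal (w y)) (volume.restrict (ball x r))

/-- Muckenhoupt class A_p for 1 < p < ∞. -/
def IsAp (p : ℝ) (w : Rn n → ℝ) : Prop :=
  ∃ C : ℝ≥0, ∀ (x : Rn n) (r : ℝ), 0 < r →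
    ((volume (ball x r))⁻¹ * (∫⁻ y in ball x r, ENNReal.ofReal (w y))) *
      ((volume (ball x r))⁻¹ *
        (∫⁻ y in ball x r, ENNReal.ofReal (w y) ^ (-(1 / (p - 1))))) ^ (p - 1) ≤ C

/-- Muckenhoupt class A_1. -/
def IsA1 (w : Rn n → ℝ) : Prop :=
  ∃ C : ℝ≥0, ∀ (x : Rn n) (r : ℝ), 0 < r →
    (volume (ball x r))⁻¹ * (∫⁻ y in ball x r, ENNReal.ofReal (w y)) ≤
      C * essInf (fun y => ENNReal.ofReal (w y)) (volume.restrict (ball x r))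

/-- Reverse Hölder class RH_r. -/
def IsRH (r : ℝ) (w : Rn n → ℝ) : Prop :=
  ∃ C : ℝ≥0, 0 < C ∧ ∀ (x : Rn n) (ρ : ℝ), 0 < ρ →
    ((volume (ball x ρ))⁻¹ * (∫⁻ y in ball x ρ, ENNReal.ofReal (w y) ^ r)) ^ (1 / r) ≤
      C * ((volume (ball x ρ))⁻¹ * (∫⁻ y in ball x ρ, ENNReal.ofReal (w y)))

/-- The integral operator `Tf(x) = ∫ K(x,y) f(y) dy`. -/
def intOp (K : Rn n → Rn n → ℝ) (f : Rn n → ℝ) (x : Rn n) : ℝ :=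
  ∫ y, K x y * f y

/-- The commutator `[b,T]f(x) = b(x)Tf(x) - T(bf)(x)`. -/
def commOp (b : Rn n → ℝ) (K : Rn n → Rn n → ℝ) (f : Rn n → ℝ) (x : Rn n) : ℝ :=
  b x * intOp K f x - intOp K (fun y => b y * f y) x


/-- Index of the cell of side `L / 2 ^ k`, in the dyadic grid based at `a`, that contains `x`. -/
def gridIdx (a : Rn n) (L : ℝ) (k : ℕ) (x : Rn n) : Fin n → ℤ :=
  fun i => ⌊2 ^ k * ((x i - a i) / L)⌋

/-- Centre of the grid cell of level `k` and index `m`. -/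
def gridCenter (a : Rn n) (L : ℝ) (k : ℕ) (m : Fin n → ℤ) : Rn n :=
  WithLp.toLp 2 fun i => a i + L / 2 ^ k * (m i + 1 / 2)

/-- A ball that contains the grid cell of level `k` and index `m`, of comparable size. -/
def gridBall (a : Rn n) (L : ℝ) (k : ℕ) (m : Fin n → ℤ) : Set (Rn n) :=
  ball (gridCenter a L k m) (n * (L / 2 ^ k))

/-- The half-open grid cell of level `k` and index `m`. -/
def gridCell (a : Rn n) (L : ℝ) (k : ℕ) (m : Fin n → ℤ) : Set (Rn n) :=
  {x | gridIdx a L k x = m}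

theorem measurable_gridIdx (a : Rn n) (L : ℝ) (k : ℕ) : Measurable (gridIdx a L k) := by
  refine measurable_pi_lambda _ fun i => Measurable.floor ?_
  fun_prop

theorem measurableSet_gridCell (a : Rn n) (L : ℝ) (k : ℕ) (m : Fin n → ℤ) :
    MeasurableSet (gridCell a L k m) :=
  measurable_gridIdx a L k (measurableSet_singleton m)

theorem floor_eq_of_floor_two_mul_eq {u v : ℝ} (h : ⌊2 * u⌋ = ⌊2 * v⌋) : ⌊u⌋ = ⌊v⌋ := by
  have key : ∀ {s t : ℝ}, ⌊2 * s⌋ = ⌊2 * t⌋ → ⌊s⌋ ≤ ⌊t⌋ := by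
    intro s t hst
    have h1 : 2 * ⌊s⌋ ≤ ⌊2 * s⌋ := by
      rw [Int.le_floor]; push_cast; linarith [Int.floor_le s]
    have h2 : (⌊2 * t⌋ : ℝ) ≤ 2 * t := Int.floor_le _
    rw [Int.le_floor]
    have h3 : ((2 * ⌊s⌋ : ℤ) : ℝ) ≤ (⌊2 * t⌋ : ℝ) := by rw [← hst]; exact_mod_cast h1
    push_cast at h3
    linarith
  exact le_antisymm (key h) (key h.symm)

theorem gridIdx_eq_of_le {a : Rn n} {L : ℝ} {k N : ℕ} (hkN : k ≤ N) {y z : Rn n}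
    (h : gridIdx a L N y = gridIdx a L N z) : gridIdx a L k y = gridIdx a L k z := by
  induction N, hkN using Nat.le_induction with
  | base => exact h
  | succ N _ ih =>
    refine ih (funext fun i => floor_eq_of_floor_two_mul_eq ?_)
    have := congrFun h i
    simp only [gridIdx, pow_succ'] at this
    simpa only [mul_assoc] using this

theorem norm_le_card_mul {v : Rn n} {c : ℝ} (h : ∀ i, |v i| ≤ c) : ‖v‖ ≤ n * c := by
  have h0 : ‖v‖ ≤ ∑ i, |v i| := by
    rw [EuclideanSpace.norm_eq]
    refine Real.sqrt_le_iff.2 ⟨Finset.sum_nonneg fun i _ => abs_nonneg _, ?_⟩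
    simpa using Finset.sum_sq_le_sq_sum_of_nonneg (s := Finset.univ) (f := fun i => |v i|)
      fun i _ => abs_nonneg _
  calc ‖v‖ ≤ ∑ i, |v i| := h0
    _ ≤ ∑ _i : Fin n, c := Finset.sum_le_sum fun i _ => h i
    _ = n * c := by simp

theorem gridIdx_eq_iff {a : Rn n} {L : ℝ} (hL : 0 < L) {k : ℕ} {x : Rn n} {m : Fin n → ℤ} :
    gridIdx a L k x = m ↔
      ∀ i, -(L / 2 ^ k / 2) ≤ x i - gridCenter a L k m i ∧
        x i - gridCenter a L k m i < L / 2 ^ k / 2 := by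
  have hl : 0 < L / 2 ^ k := by positivity
  rw [funext_iff]
  refine forall_congr' fun i => ?_
  have e : 2 ^ k * ((x i - a i) / L) = (x i - a i) / (L / 2 ^ k) := by field_simp
  simp only [gridIdx, gridCenter, e]
  rw [Int.floor_eq_iff, le_div_iff₀ hl, div_lt_iff₀ hl]
  constructor <;> rintro ⟨h1, h2⟩ <;> constructor <;> linarith

theorem ball_subset_gridCell {a : Rn n} {L : ℝ} (hL : 0 < L) (k : ℕ) (m : Fin n → ℤ) :
    ball (gridCenter a L k m) (L / 2 ^ k / 2) ⊆ gridCell a L k m := by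
  intro x hx
  refine (gridIdx_eq_iff hL).2 fun i => ?_
  have h1 : |x i - gridCenter a L k m i| < L / 2 ^ k / 2 := by
    have := EuclideanSpace.norm_eq (x - gridCenter a L k m)
    refine lt_of_le_of_lt ?_ (mem_ball_iff_norm.1 hx)
    simpa using PiLp.norm_apply_le (x - gridCenter a L k m) i
  exact ⟨(abs_lt.1 h1).1.le, (abs_lt.1 h1).2⟩

theorem gridCell_subset_closedBall {a : Rn n} {L : ℝ} (hL : 0 < L) (k : ℕ) (m : Fin n → ℤ) :
    gridCell a L k m ⊆ closedBall (gridCenter a L k m) (n * (L / 2 ^ k / 2)) := by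
  intro x hx
  have h := (gridIdx_eq_iff hL).1 hx
  rw [mem_closedBall_iff_norm]
  refine norm_le_card_mul fun i => ?_
  simpa using abs_le.2 ⟨(h i).1, (h i).2.le⟩

theorem gridCell_subset_gridBall [NeZero n] {a : Rn n} {L : ℝ} (hL : 0 < L) (k : ℕ)
    (m : Fin n → ℤ) : gridCell a L k m ⊆ gridBall a L k m := by
  refine (gridCell_subset_closedBall hL k m).trans (closedBall_subset_ball ?_)
  have hn : (0 : ℝ) < n := by exact_mod_cast Nat.pos_of_neZero n
  have : 0 < L / 2 ^ k := by positivity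
  nlinarith

theorem gridCenter_mem {a : Rn n} {L : ℝ} (hL : 0 < L) (k : ℕ) (m : Fin n → ℤ) :
    gridCenter a L k m ∈ gridCell a L k m :=
  ball_subset_gridCell hL k m (mem_ball_self (by positivity))

theorem gridBall_succ_subset {a : Rn n} {L : ℝ} (hL : 0 < L) (k : ℕ) (x : Rn n) :
    gridBall a L (k + 1) (gridIdx a L (k + 1) x) ⊆ gridBall a L k (gridIdx a L k x) := by
  set c := gridCenter a L (k + 1) (gridIdx a L (k + 1) x)
  have hc : c ∈ gridCell a L k (gridIdx a L k x) :=
    gridIdx_eq_of_le (Nat.le_succ k) (gridCenter_mem hL (k + 1) (gridIdx a L (k + 1) x))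
  have hd := mem_closedBall.1 (gridCell_subset_closedBall hL k _ hc)
  refine ball_subset_ball' ?_
  have e : L / 2 ^ (k + 1) = L / 2 ^ k / 2 := by rw [pow_succ, div_div]
  rw [e]
  linarith

theorem volume_ball_mul {x y : Rn n} {c r : ℝ} (hc : 0 < c) :
    volume (ball x (c * r)) = ENNReal.ofReal (c ^ n) * volume (ball y r) := by
  rw [Measure.addHaar_ball_mul_of_pos volume x hc r, ← Measure.addHaar_ball_center volume y r]
  simp

theorem volume_gridBall_le [NeZero n] {a : Rn n} {L : ℝ} (hL : 0 < L) (k : ℕ) (m : Fin n → ℤ) :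
    volume (gridBall a L k m) ≤ ENNReal.ofReal ((2 * n) ^ n) * volume (gridCell a L k m) := by
  have hn : (0 : ℝ) < n := by exact_mod_cast Nat.pos_of_neZero n
  have e : (n : ℝ) * (L / 2 ^ k) = 2 * n * (L / 2 ^ k / 2) := by ring
  rw [gridBall, e, volume_ball_mul (y := gridCenter a L k m) (by positivity)]
  gcongr
  exact ball_subset_gridCell hL k m

theorem lintegral_ball_sub_avg_le (b : Rn n → ℝ) (x : Rn n) {r : ℝ} (hr : 0 < r) :
    ∫⁻ y in ball x r, ENNReal.ofReal |b y - avg b (ball x r)| ≤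
      bmoNorm b * volume (ball x r) := by
  have h : (volume (ball x r))⁻¹ * ∫⁻ y in ball x r, ENNReal.ofReal |b y - avg b (ball x r)| ≤
      bmoNorm b := by
    unfold bmoNorm
    exact le_iSup_of_le x (le_iSup_of_le r (le_iSup_of_le hr le_rfl))
  rw [mul_comm, ← div_eq_mul_inv] at h
  exact (ENNReal.div_le_iff (measure_ball_pos _ _ hr).ne' measure_ball_lt_top.ne).1 h

theorem volume_mul_ofReal_abs_sub_le {b : Rn n → ℝ} (hb : AEMeasurable b volume) (A : Set (Rn n))
    (u v : ℝ) : volume A * ENNReal.ofReal |u - v| ≤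
      (∫⁻ y in A, ENNReal.ofReal |b y - u|) + ∫⁻ y in A, ENNReal.ofReal |b y - v| := by
  rw [← lintegral_add_left' (by fun_prop), mul_comm, ← setLIntegral_const]
  refine lintegral_mono fun y => ?_
  rw [← ENNReal.ofReal_add (abs_nonneg _) (abs_nonneg _)]
  refine ENNReal.ofReal_le_ofReal ?_
  rw [abs_sub_comm (b y) u]
  exact abs_sub_le _ _ _

theorem abs_avg_sub_avg_le {b : Rn n → ℝ} (hb : AEMeasurable b volume) {M D : ℝ} (hM : 0 ≤ M)
    (hD : 0 ≤ D) (hbM : bmoNorm b ≤ ENNReal.ofReal M) {x x' : Rn n} {r r' : ℝ} (hr : 0 < r)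
    (hr' : 0 < r') (hsub : ball x r ⊆ ball x' r')
    (hvol : volume (ball x' r') ≤ ENNReal.ofReal D * volume (ball x r)) :
    |avg b (ball x r) - avg b (ball x' r')| ≤ (1 + D) * M := by
  have h1 := volume_mul_ofReal_abs_sub_le hb (ball x r) (avg b (ball x r)) (avg b (ball x' r'))
  have h2 : volume (ball x r) * ENNReal.ofReal |avg b (ball x r) - avg b (ball x' r')| ≤
      volume (ball x r) * ENNReal.ofReal ((1 + D) * M) := by
    refine h1.trans ?_
    calc _ ≤ bmoNorm b * volume (ball x r) + bmoNorm b * volume (ball x' r') := by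
          refine add_le_add (lintegral_ball_sub_avg_le b x hr) ?_
          exact (lintegral_mono_set hsub).trans (lintegral_ball_sub_avg_le b x' hr')
      _ ≤ ENNReal.ofReal M * volume (ball x r) +
          ENNReal.ofReal M * (ENNReal.ofReal D * volume (ball x r)) := by gcongr
      _ = volume (ball x r) * ENNReal.ofReal ((1 + D) * M) := by
          rw [ENNReal.ofReal_mul (by positivity), ENNReal.ofReal_add zero_le_one hD,
            ENNReal.ofReal_one]
          ring
  rw [ENNReal.mul_le_mul_iff_right (measure_ball_pos _ _ hr).ne' measure_ball_lt_top.ne] at h2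
  exact (ENNReal.ofReal_le_ofReal_iff (by positivity)).1 h2

theorem avg_closedBall_eq [NeZero n] (b : Rn n → ℝ) (x : Rn n) (r : ℝ) :
    ⨍ y in closedBall x r, b y = avg b (ball x r) := by
  refine setAverage_congr (ae_eq_of_subset_of_measure_ge ball_subset_closedBall ?_
    measurableSet_ball.nullMeasurableSet measure_closedBall_lt_top.ne).symm
  exact (Measure.addHaar_closedBall_eq_addHaar_ball volume x r).le

theorem ae_tendsto_avg_gridBall [NeZero n] {b : Rn n → ℝ} (hb : LocallyIntegrable b volume)
    (a : Rn n) {L : ℝ} (hL : 0 < L) :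
    ∀ᵐ y, Filter.Tendsto (fun k => avg b (gridBall a L k (gridIdx a L k y))) Filter.atTop
      (nhds (b y)) := by
  have hn : (0 : ℝ) < n := by exact_mod_cast Nat.pos_of_neZero n
  filter_upwards [IsUnifLocDoublingMeasure.ae_tendsto_average (μ := volume) hb 1] with y hy
  have := hy (ι := ℕ) (l := Filter.atTop) (fun k => gridCenter a L k (gridIdx a L k y))
    (fun k => n * (L / 2 ^ k)) ?_ ?_
  · simp only [avg_closedBall_eq] at this
    exact this
  · refine tendsto_nhdsWithin_iff.2 ⟨?_, .of_forall fun k => ?_⟩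
    · have h := (tendsto_pow_atTop_nhds_zero_of_lt_one (r := (1 / 2 : ℝ)) (by norm_num)
        (by norm_num)).const_mul (n * L)
      simp only [mul_zero] at h
      refine h.congr fun k => ?_
      rw [one_div, inv_pow]; ring
    · exact mem_Ioi.2 (by positivity)
  · refine .of_forall fun k => ?_
    rw [one_mul]
    exact ball_subset_closedBall (gridCell_subset_gridBall hL k _ rfl)

/-- Exponential decay of the distribution function of a BMO function on grid cells, with respect to
a measure that gives a fixed proportion of each cell at most to subsets of half the volume. -/
theorem measure_gridCell_abs_sub_gt_le [NeZero n] {b : Rn n → ℝ} (hb : LocallyIntegrable b volume)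
    {M D : ℝ} (hM : 0 < M) (hD : D = (2 * n) ^ n) (hbM : bmoNorm b ≤ ENNReal.ofReal M)
    {a : Rn n} {L : ℝ} (hL : 0 < L) {μ : Measure (Rn n)} (hμ : μ ≪ volume) {δ : ℝ≥0∞}
    (hδ : ∀ k m E, MeasurableSet E → E ⊆ gridCell a L k m →
      2 * volume E ≤ volume (gridCell a L k m) → μ E ≤ δ * μ (gridCell a L k m)) (j : ℕ) :
    ∀ (k : ℕ) (m : Fin n → ℤ),
      μ {y ∈ gridCell a L k m | j * ((4 * D + 1) * M) < |b y - avg b (gridBall a L k m)|} ≤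
        δ ^ j * μ (gridCell a L k m) := by
  have hn : (0 : ℝ) < n := by exact_mod_cast Nat.pos_of_neZero n
  have hD0 : 0 < D := by rw [hD]; positivity
  have hbm : AEMeasurable b volume := hb.aestronglyMeasurable.aemeasurable
  set β : ℕ → (Fin n → ℤ) → ℝ := fun k m => avg b (gridBall a L k m) with hβ
  have hstep : ∀ k x, |β (k + 1) (gridIdx a L (k + 1) x) - β k (gridIdx a L k x)| ≤
      (1 + D) * M := by
    intro k x
    refine abs_avg_sub_avg_le hbm hM.le hD0.le hbM (by positivity) (by positivity)
      (gridBall_succ_subset hL k x) ?_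
    have e : (n : ℝ) * (L / 2 ^ k) = 2 * (n * (L / 2 ^ (k + 1))) := by
      rw [pow_succ]; field_simp
    rw [e, volume_ball_mul (y := gridCenter a L (k + 1) (gridIdx a L (k + 1) x)) two_pos]
    gcongr
    rw [hD]
    gcongr
    have : (1 : ℝ) ≤ n := by exact_mod_cast Nat.pos_of_neZero n
    linarith
  have hcell : ∀ k m, ∫⁻ y in gridCell a L k m, ENNReal.ofReal |b y - β k m| ≤
      ENNReal.ofReal (D * M) * volume (gridCell a L k m) := by
    intro k m
    calc _ ≤ ∫⁻ y in gridBall a L k m, ENNReal.ofReal |b y - β k m| :=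
          lintegral_mono_set (gridCell_subset_gridBall hL k m)
      _ ≤ bmoNorm b * volume (gridBall a L k m) :=
          lintegral_ball_sub_avg_le b _ (by positivity)
      _ ≤ ENNReal.ofReal M * (ENNReal.ofReal D * volume (gridCell a L k m)) := by
          gcongr
          rw [hD]
          exact volume_gridBall_le hL k m
      _ = _ := by rw [ENNReal.ofReal_mul hD0.le]; ring
  have hfin : ∀ k m, volume (gridCell a L k m) ≠ ∞ := fun k m =>
    ((measure_mono (gridCell_subset_gridBall hL k m)).trans_lt measure_ball_lt_top).ne
  induction j with
  | zero => intro k m; simpa using measure_mono (sep_subset _ _)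
  | succ j ih =>
    intro k m
    let A : ℕ × (Fin n → ℤ) → Set (Rn n) := fun p =>
      {y | gridIdx a L k y = m ∧ gridIdx a L p.1 y = p.2 ∧ k ≤ p.1 ∧
        3 * D * M < |β p.1 (gridIdx a L p.1 y) - β k m| ∧
        ∀ i, k ≤ i → i < p.1 → |β i (gridIdx a L i y) - β k m| ≤ 3 * D * M}
    have hA : ∀ p y, y ∈ A p → A p = gridCell a L p.1 p.2 := by
      rintro p y ⟨h1, h2, h3, h4, h5⟩
      refine Subset.antisymm (fun z hz => hz.2.1) fun z hz => ?_
      have hz' : gridIdx a L p.1 z = gridIdx a L p.1 y := hz.trans h2.symm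
      refine ⟨(gridIdx_eq_of_le h3 hz').trans h1, hz, h3, by rwa [hz'], fun i hi hip => ?_⟩
      rw [gridIdx_eq_of_le hip.le hz']
      exact h5 i hi hip
    have hAm : ∀ p, MeasurableSet (A p) := by
      intro p
      rcases (A p).eq_empty_or_nonempty with h | ⟨y, hy⟩
      · rw [h]; exact .empty
      · rw [hA p y hy]; exact measurableSet_gridCell _ _ _ _
    have hAd : Pairwise (Function.onFun Disjoint A) := by
      rintro ⟨N, u⟩ ⟨N', u'⟩ hne
      refine Set.disjoint_left.2 ?_
      rintro y ⟨-, h2, h3, h4, h5⟩ ⟨-, h2', h3', h4', h5'⟩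
      rcases lt_trichotomy N N' with h | h | h
      · exact absurd h4 (not_lt.2 (h5' N h3 h))
      · subst h
        exact hne (Prod.ext rfl (h2.symm.trans h2'))
      · exact absurd h4' (not_lt.2 (h5 N' h3' h))
    have hAsub : (⋃ p, A p) ⊆ gridCell a L k m := iUnion_subset fun p y hy => hy.1
    have hAμ : ∀ p, μ {y ∈ A p | (j + 1 : ℕ) * ((4 * D + 1) * M) < |b y - β k m|} ≤
        δ ^ j * μ (A p) := by
      intro p
      rcases (A p).eq_empty_or_nonempty with h | ⟨y, hy⟩
      · simp [h]
      refine (measure_mono ?_).trans ((ih p.1 p.2).trans (by rw [hA p y hy]))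
      rintro z ⟨hz, hbz⟩
      refine ⟨hz.2.1, ?_⟩
      have hdiff : |β p.1 p.2 - β k m| ≤ (4 * D + 1) * M := by
        obtain ⟨h1, h2, h3, h4, h5⟩ := hz
        rcases h3.eq_or_lt with h | h
        · rw [← h] at h2 ⊢
          rw [← h2, h1]
          simp only [sub_self, abs_zero]
          positivity
        · obtain ⟨N, hN⟩ : ∃ N, p.1 = N + 1 := ⟨p.1 - 1, by omega⟩
          rw [hN] at h2 ⊢
          have h6 := h5 N (by omega) (by omega)
          have h7 := hstep N z
          rw [h2] at h7
          have h8 := abs_sub_le (β (N + 1) p.2) (β N (gridIdx a L N z)) (β k m)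
          linarith
      have h9 := abs_sub_le (b z) (β p.1 p.2) (β k m)
      push_cast at hbz
      simp only [hβ] at *
      linarith
    have hAv : ∀ p, ENNReal.ofReal (D * M) * (2 * volume (A p)) ≤
        ∫⁻ y in A p, ENNReal.ofReal |b y - β k m| := by
      intro p
      rcases (A p).eq_empty_or_nonempty with h | ⟨y, hy⟩
      · simp [h]
      have h1 := volume_mul_ofReal_abs_sub_le hbm (A p) (β p.1 p.2) (β k m)
      have h2 : ∫⁻ y in A p, ENNReal.ofReal |b y - β p.1 p.2| ≤
          ENNReal.ofReal (D * M) * volume (A p) := by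
        rw [hA p y hy]; exact hcell _ _
      have h3 : ENNReal.ofReal (3 * D * M) ≤ ENNReal.ofReal |β p.1 p.2 - β k m| := by
        refine ENNReal.ofReal_le_ofReal ?_
        have := hy.2.2.2.1
        rw [hy.2.1] at this
        exact this.le
      have h4 : ENNReal.ofReal (D * M) * volume (A p) ≠ ∞ := by
        rw [hA p y hy]
        exact ENNReal.mul_ne_top ENNReal.ofReal_ne_top (hfin _ _)
      refine (ENNReal.add_le_add_iff_left h4).1 ?_
      calc _ = volume (A p) * ENNReal.ofReal (3 * D * M) := by
            rw [mul_assoc, ENNReal.ofReal_mul (by norm_num : (0 : ℝ) ≤ 3)]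
            norm_num
            ring
        _ ≤ volume (A p) * ENNReal.ofReal |β p.1 p.2 - β k m| := by gcongr
        _ ≤ _ := h1.trans (add_le_add_left h2 _)
    have hhalf : 2 * volume (⋃ p, A p) ≤ volume (gridCell a L k m) := by
      have h1 : ENNReal.ofReal (D * M) * (2 * volume (⋃ p, A p)) ≤
          ENNReal.ofReal (D * M) * volume (gridCell a L k m) := by
        rw [measure_iUnion hAd hAm, ← ENNReal.tsum_mul_left, ← ENNReal.tsum_mul_left]
        calc _ ≤ ∑' p, ∫⁻ y in A p, ENNReal.ofReal |b y - β k m| := ENNReal.tsum_le_tsum hAv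
          _ = ∫⁻ y in ⋃ p, A p, ENNReal.ofReal |b y - β k m| :=
              (lintegral_iUnion hAm hAd _).symm
          _ ≤ _ := (lintegral_mono_set hAsub).trans (hcell k m)
      rwa [ENNReal.mul_le_mul_iff_right (by simpa using by positivity) ENNReal.ofReal_ne_top] at h1
    have hcover : {y ∈ gridCell a L k m | (j + 1 : ℕ) * ((4 * D + 1) * M) < |b y - β k m|} ≤ᵐ[μ]
        ⋃ p, {y ∈ A p | (j + 1 : ℕ) * ((4 * D + 1) * M) < |b y - β k m|} := by
      filter_upwards [hμ.ae_le (ae_tendsto_avg_gridBall hb a hL)] with y hy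
      rintro ⟨hym, hyb⟩
      have hlt : 3 * D * M < |b y - β k m| := by
        refine lt_of_le_of_lt ?_ hyb
        push_cast
        have : 0 ≤ j * ((4 * D + 1) * M) := by positivity
        nlinarith [mul_pos hD0 hM]
      have hev : ∀ᶠ N in Filter.atTop, 3 * D * M < |β N (gridIdx a L N y) - β k m| :=
        ((hy.sub_const (β k m)).abs).eventually (lt_mem_nhds hlt)
      have hex : ∃ N, k ≤ N ∧ 3 * D * M < |β N (gridIdx a L N y) - β k m| :=
        ((Filter.eventually_ge_atTop k).and hev).exists
      classical
      have hmem : y ∈ A (Nat.find hex, gridIdx a L (Nat.find hex) y) := by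
        refine ⟨hym, rfl, (Nat.find_spec hex).1, (Nat.find_spec hex).2, fun i hi hlt => ?_⟩
        have := Nat.find_min hex hlt
        exact not_lt.1 fun h => this ⟨hi, h⟩
      exact mem_iUnion.2 ⟨_, hmem, hyb⟩
    calc _ ≤ μ (⋃ p, {y ∈ A p | (j + 1 : ℕ) * ((4 * D + 1) * M) < |b y - β k m|}) :=
          measure_mono_ae hcover
      _ ≤ ∑' p, μ {y ∈ A p | (j + 1 : ℕ) * ((4 * D + 1) * M) < |b y - β k m|} :=
          measure_iUnion_le _
      _ ≤ ∑' p, δ ^ j * μ (A p) := ENNReal.tsum_le_tsum hAμ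
      _ = δ ^ j * μ (⋃ p, A p) := by rw [ENNReal.tsum_mul_left, measure_iUnion hAd hAm]
      _ ≤ δ ^ j * (δ * μ (gridCell a L k m)) := by
          gcongr
          exact hδ k m _ (.iUnion hAm) hAsub hhalf
      _ = _ := by rw [pow_succ, mul_assoc]

/-- A quantitative absolute continuity of volume with respect to `μ` inside balls, the form in
which the Muckenhoupt condition is used. -/
def VolumeControlled (μ : Measure (Rn n)) (S : ℝ) (C : ℝ≥0) : Prop :=
  ∀ (x : Rn n) (r : ℝ) (E : Set (Rn n)), 0 < r → MeasurableSet E → E ⊆ ball x r →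
    volume E ^ S * μ (ball x r) ≤ C * volume (ball x r) ^ S * μ E

theorem VolumeControlled.measure_ball_le {μ : Measure (Rn n)} {S : ℝ} {C : ℝ≥0}
    (h : VolumeControlled μ S C) (hS : 0 ≤ S) {x : Rn n} {r D : ℝ} (hr : 0 < r)
    {E : Set (Rn n)} (hE : MeasurableSet E) (hEB : E ⊆ ball x r)
    (hvol : volume (ball x r) ≤ ENNReal.ofReal D * volume E) :
    μ (ball x r) ≤ C * ENNReal.ofReal D ^ S * μ E := by
  have hB : volume (ball x r) ≠ 0 := (measure_ball_pos _ _ hr).ne'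
  have hE0 : volume E ≠ 0 := by
    intro h0
    rw [h0, mul_zero] at hvol
    exact hB (le_antisymm hvol zero_le)
  have hEt : volume E ≠ ∞ := ((measure_mono hEB).trans_lt measure_ball_lt_top).ne
  have h1 : volume E ^ S ≠ 0 := (ENNReal.rpow_pos (pos_iff_ne_zero.2 hE0) hEt).ne'
  have h2 : volume E ^ S ≠ ∞ := ENNReal.rpow_ne_top_of_nonneg hS hEt
  refine (ENNReal.mul_le_mul_iff_right h1 h2).1 ?_
  calc _ ≤ C * volume (ball x r) ^ S * μ E := h x r E hr hE hEB
    _ ≤ C * (ENNReal.ofReal D * volume E) ^ S * μ E := by gcongr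
    _ = _ := by rw [ENNReal.mul_rpow_of_nonneg _ _ hS]; ring

theorem measure_le_mul_of_measure_le_mul_sdiff {μ : Measure (Rn n)} {Q E : Set (Rn n)} {A : ℝ≥0∞}
    (hE : MeasurableSet E) (hEQ : E ⊆ Q) (hμQ : μ Q ≠ ∞) (h : μ Q ≤ A * μ (Q \ E)) :
    μ E ≤ (1 - (A + 1)⁻¹) * μ Q := by
  have hQF : (A + 1)⁻¹ * μ Q ≤ μ (Q \ E) := by
    rw [mul_comm, ← div_eq_mul_inv]
    exact ENNReal.div_le_of_le_mul' (h.trans (by gcongr; exact le_self_add))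
  rw [ENNReal.sub_mul (fun _ _ => hμQ), one_mul]
  refine ENNReal.le_sub_of_add_le_right
    (ne_top_of_le_ne_top hμQ (hQF.trans (measure_mono sdiff_subset))) ?_
  calc μ E + (A + 1)⁻¹ * μ Q ≤ μ E + μ (Q \ E) := by gcongr
    _ = μ Q := by rw [measure_add_sdiff hE.nullMeasurableSet, union_eq_self_of_subset_left hEQ]

theorem VolumeControlled.exists_ball_ratio [NeZero n] {μ : Measure (Rn n)} {S : ℝ} {C : ℝ≥0}
    (h : VolumeControlled μ S C) (hS : 0 ≤ S) (hfin : ∀ x r, μ (ball x r) ≠ ∞) :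
    ∃ δ : ℝ≥0∞, δ < 1 ∧ ∀ (x : Rn n) (r : ℝ), 0 < r →
      μ (ball x r) ≤ δ * μ (ball x (4 * r)) := by
  set A : ℝ≥0∞ := C * ENNReal.ofReal 2 ^ S with hA
  have hAt : A ≠ ∞ :=
    ENNReal.mul_ne_top ENNReal.coe_ne_top (ENNReal.rpow_ne_top_of_nonneg hS ENNReal.ofReal_ne_top)
  refine ⟨1 - (A + 1)⁻¹, ENNReal.sub_lt_self ENNReal.one_ne_top one_ne_zero ?_, ?_⟩
  · exact ENNReal.inv_ne_zero.2 (ENNReal.add_ne_top.2 ⟨hAt, ENNReal.one_ne_top⟩)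
  intro x r hr
  have hsub : ball x r ⊆ ball x (4 * r) := ball_subset_ball (by linarith)
  refine measure_le_mul_of_measure_le_mul_sdiff measurableSet_ball hsub (hfin _ _) ?_
  refine h.measure_ball_le hS (by positivity) (measurableSet_ball.diff measurableSet_ball)
    sdiff_subset ?_
  have hsplit : volume (ball x r) + volume (ball x (4 * r) \ ball x r) = volume (ball x (4 * r)) := by
    rw [measure_add_sdiff measurableSet_ball.nullMeasurableSet, union_eq_self_of_subset_left hsub]
  have h2 : 2 * volume (ball x r) ≤ volume (ball x (4 * r)) := by
    rw [volume_ball_mul (y := x) four_pos]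
    gcongr
    rw [← ENNReal.ofReal_ofNat]
    refine ENNReal.ofReal_le_ofReal ?_
    calc (2 : ℝ) ≤ 4 ^ 1 := by norm_num
      _ ≤ 4 ^ n := pow_le_pow_right₀ (by norm_num) (Nat.pos_of_neZero n)
  refine (ENNReal.add_le_add_iff_left (measure_ball_lt_top (μ := volume) (x := x) (r := 4 * r)).ne).1 ?_
  calc volume (ball x (4 * r)) + volume (ball x (4 * r)) =
        2 * volume (ball x r) + ENNReal.ofReal 2 * volume (ball x (4 * r) \ ball x r) := by
        rw [ENNReal.ofReal_ofNat, ← two_mul, ← mul_add, hsplit]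
    _ ≤ _ := by gcongr

theorem VolumeControlled.exists_gridCell_ratio [NeZero n] {μ : Measure (Rn n)} {S : ℝ} {C : ℝ≥0}
    (h : VolumeControlled μ S C) (hS : 0 ≤ S) (hfin : ∀ x r, μ (ball x r) ≠ ∞) :
    ∃ δ : ℝ≥0∞, δ < 1 ∧ ∀ (a : Rn n) (L : ℝ), 0 < L → ∀ k m E, MeasurableSet E →
      E ⊆ gridCell a L k m → 2 * volume E ≤ volume (gridCell a L k m) →
        μ E ≤ δ * μ (gridCell a L k m) := by
  have hn : (0 : ℝ) < n := by exact_mod_cast Nat.pos_of_neZero n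
  set D : ℝ := (2 * n) ^ n * 2 with hD
  set A : ℝ≥0∞ := C * ENNReal.ofReal D ^ S with hA
  have hAt : A ≠ ∞ :=
    ENNReal.mul_ne_top ENNReal.coe_ne_top (ENNReal.rpow_ne_top_of_nonneg hS ENNReal.ofReal_ne_top)
  refine ⟨1 - (A + 1)⁻¹, ENNReal.sub_lt_self ENNReal.one_ne_top one_ne_zero ?_, ?_⟩
  · exact ENNReal.inv_ne_zero.2 (ENNReal.add_ne_top.2 ⟨hAt, ENNReal.one_ne_top⟩)
  intro a L hL k m E hE hEQ hvol
  set Q := gridCell a L k m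
  have hQm : MeasurableSet Q := measurableSet_gridCell _ _ _ _
  have hQB : Q ⊆ gridBall a L k m := gridCell_subset_gridBall hL k m
  have hvQ : volume Q ≠ ∞ := ((measure_mono hQB).trans_lt measure_ball_lt_top).ne
  have hμQ : μ Q ≠ ∞ := ((measure_mono hQB).trans_lt (hfin _ _).lt_top).ne
  have hsplit : volume Q = volume E + volume (Q \ E) := by
    rw [measure_add_sdiff hE.nullMeasurableSet, union_eq_self_of_subset_left hEQ]
  have hF : volume Q ≤ 2 * volume (Q \ E) := by
    refine (ENNReal.add_le_add_iff_left hvQ).1 ?_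
    calc volume Q + volume Q = 2 * volume E + 2 * volume (Q \ E) := by
          rw [← two_mul, ← mul_add, ← hsplit]
      _ ≤ volume Q + 2 * volume (Q \ E) := by gcongr
  have hball : μ (gridBall a L k m) ≤ A * μ (Q \ E) := by
    refine h.measure_ball_le hS (by positivity) (hQm.diff hE) (sdiff_subset.trans hQB) ?_
    calc _ ≤ ENNReal.ofReal ((2 * n) ^ n) * volume Q := volume_gridBall_le hL k m
      _ ≤ ENNReal.ofReal ((2 * n) ^ n) * (2 * volume (Q \ E)) := by gcongr
      _ = _ := by
        rw [hD, ENNReal.ofReal_mul (by positivity), ENNReal.ofReal_ofNat, mul_assoc]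
  exact measure_le_mul_of_measure_le_mul_sdiff hE hEQ hμQ ((measure_mono hQB).trans hball)

theorem tsum_ofReal_rpow_mul_pow_ne_top {c q : ℝ} (hc : 1 ≤ c) {δ : ℝ≥0∞} (hδ : δ < 1) :
    ∑' j : ℕ, ENNReal.ofReal ((j + 2) * c) ^ q * δ ^ j ≠ ∞ := by
  obtain ⟨d, hδd, hd1⟩ := ENNReal.lt_iff_exists_nnreal_btwn.1 hδ
  have hd0 : (0 : ℝ) < d := by
    have : (0 : ℝ≥0∞) < d := zero_le.trans_lt hδd
    exact_mod_cast this
  have hd1' : (d : ℝ) < 1 := by exact_mod_cast hd1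
  have hs : Summable fun j : ℕ => (((j + 2) * c) ^ ⌈q⌉₊ * (d : ℝ) ^ j) := by
    have h1 := summable_pow_mul_geometric_of_norm_lt_one ⌈q⌉₊ (r := (d : ℝ))
      (by rwa [Real.norm_of_nonneg hd0.le])
    have h2 := ((summable_nat_add_iff 2).2 h1).mul_left (c ^ ⌈q⌉₊ * ((d : ℝ) ^ 2)⁻¹)
    refine h2.congr fun j => ?_
    push_cast
    rw [mul_pow, pow_add]
    field_simp
  refine ne_top_of_le_ne_top hs.tsum_ofReal_ne_top (ENNReal.tsum_le_tsum fun j => ?_)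
  have hj : 1 ≤ (j + 2) * c := by
    have : (0 : ℝ) ≤ j := by positivity
    nlinarith
  rw [ENNReal.ofReal_mul (p := ((j + 2) * c) ^ ⌈q⌉₊) (by positivity),
    ENNReal.ofReal_pow (by positivity), ENNReal.ofReal_pow hd0.le, ENNReal.ofReal_coe_nnreal]
  gcongr
  rw [← ENNReal.rpow_natCast]
  exact ENNReal.rpow_le_rpow_of_exponent_le (by simpa using hj) (Nat.le_ceil q)

/-- John–Nirenberg inequality in `L^q(μ)`. -/
theorem VolumeControlled.exists_lintegral_sub_avg_rpow_le [NeZero n] {μ : Measure (Rn n)} {S : ℝ}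
    {C : ℝ≥0} (h : VolumeControlled μ S C) (hS : 0 ≤ S) (hfin : ∀ x r, μ (ball x r) ≠ ∞)
    (hμ : μ ≪ volume) {q : ℝ} (hq : 0 < q) :
    ∃ C' : ℝ≥0∞, C' ≠ ∞ ∧ ∀ b : Rn n → ℝ, IsBMO b → ∀ (x : Rn n) (r : ℝ), 0 < r →
      ∫⁻ y in ball x r, ENNReal.ofReal |b y - avg b (ball x r)| ^ q ∂μ ≤
        C' * bmoNorm b ^ q * μ (ball x r) := by
  have hn1 : (1 : ℝ) ≤ n := by exact_mod_cast Nat.pos_of_neZero n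
  set D : ℝ := (2 * n) ^ n with hD
  have hD0 : 0 < D := by positivity
  obtain ⟨δ, hδ1, hδ⟩ := h.exists_gridCell_ratio hS hfin
  set G : ℝ≥0∞ := ∑' j : ℕ, ENNReal.ofReal ((j + 2) * (4 * D + 1)) ^ q * δ ^ j with hG
  have hGt : G ≠ ∞ := tsum_ofReal_rpow_mul_pow_ne_top (by linarith) hδ1
  refine ⟨G * (C * ENNReal.ofReal D ^ S), ?_, fun b hb x r hr => ?_⟩
  · exact ENNReal.mul_ne_top hGt (ENNReal.mul_ne_top ENNReal.coe_ne_top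
      (ENNReal.rpow_ne_top_of_nonneg hS ENNReal.ofReal_ne_top))
  have hbm : AEMeasurable b volume := hb.1.aestronglyMeasurable.aemeasurable
  rcases eq_or_ne (bmoNorm b) 0 with h0 | h0
  · have h1 := lintegral_ball_sub_avg_le b x hr
    rw [h0, zero_mul, nonpos_iff_eq_zero, lintegral_eq_zero_iff' (by fun_prop)] at h1
    have h2 := (hμ.restrict (ball x r)).ae_le h1
    rw [lintegral_congr_ae (g := 0)]
    · simp
    · filter_upwards [h2] with y hy
      rw [hy]
      simp [hq]
  set M : ℝ := (bmoNorm b).toReal with hM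
  have hM0 : 0 < M := ENNReal.toReal_pos h0 hb.2
  have hMb : ENNReal.ofReal M = bmoNorm b := ENNReal.ofReal_toReal hb.2
  set T : ℝ := (4 * D + 1) * M with hT
  have hT0 : 0 < T := by positivity
  let a : Rn n := WithLp.toLp 2 fun i => x i - r
  have hL : 0 < 2 * r := by positivity
  have hcen : gridCenter a (2 * r) 0 0 = x := by
    ext i
    simp only [gridCenter, a, pow_zero, div_one, Pi.zero_apply, Int.cast_zero]
    ring
  have hgb : gridBall a (2 * r) 0 0 = ball x (2 * n * r) := by
    rw [gridBall, hcen]; congr 1; ring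
  have hBQ : ball x r ⊆ gridCell a (2 * r) 0 0 := by
    have := ball_subset_gridCell (a := a) hL 0 0
    rw [hcen] at this
    simpa using this
  have hBB : ball x r ⊆ ball x (2 * n * r) := ball_subset_ball (by nlinarith)
  have hvol : volume (ball x (2 * n * r)) ≤ ENNReal.ofReal D * volume (ball x r) :=
    (volume_ball_mul (by positivity)).le
  have hQμ : μ (gridCell a (2 * r) 0 0) ≤ C * ENNReal.ofReal D ^ S * μ (ball x r) := by
    refine (measure_mono (gridCell_subset_gridBall hL 0 0)).trans ?_
    rw [hgb]
    exact h.measure_ball_le hS (by positivity) measurableSet_ball hBB hvol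
  set β : ℝ := avg b (ball x (2 * n * r)) with hβ
  have hdiff : |β - avg b (ball x r)| ≤ T := by
    rw [abs_sub_comm]
    refine (abs_avg_sub_avg_le hbm hM0.le hD0.le hMb.ge hr (by positivity) hBB hvol).trans ?_
    rw [hT]
    gcongr ?_ * M
    linarith
  let E : ℕ → Set (Rn n) := fun j =>
    {y ∈ gridCell a (2 * r) 0 0 | (j = 0 ∨ j * T < |b y - β|) ∧ |b y - β| ≤ (j + 1) * T}
  have hEμ : ∀ j, μ (E j) ≤ δ ^ j * μ (gridCell a (2 * r) 0 0) := by
    intro j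
    rcases Nat.eq_zero_or_pos j with rfl | hj
    · simpa using measure_mono (sep_subset _ _)
    · have := measure_gridCell_abs_sub_gt_le hb.1 hM0 hD hMb.ge hL hμ (hδ a _ hL) j 0 0
      rw [hgb] at this
      refine (measure_mono ?_).trans this
      rintro y ⟨hy, h1, -⟩
      exact ⟨hy, h1.resolve_left hj.ne'⟩
  have hcover : ball x r ⊆ ⋃ j, E j := by
    intro y hy
    have hex : ∃ j : ℕ, |b y - β| ≤ (j + 1) * T := by
      obtain ⟨j, hj⟩ := exists_nat_ge (|b y - β| / T)
      rw [div_le_iff₀ hT0] at hj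
      exact ⟨j, by linarith⟩
    classical
    refine mem_iUnion.2 ⟨Nat.find hex, hBQ hy, ?_, Nat.find_spec hex⟩
    rcases Nat.eq_zero_or_pos (Nat.find hex) with hj | hj
    · exact .inl hj
    · right
      have := not_le.1 (Nat.find_min hex (Nat.sub_lt hj one_pos))
      rwa [Nat.cast_pred hj, sub_add_cancel] at this
  calc _ ≤ ∑' j, ∫⁻ y in E j, ENNReal.ofReal |b y - avg b (ball x r)| ^ q ∂μ :=
        (lintegral_mono_set hcover).trans (lintegral_iUnion_le _ _)
    _ ≤ ∑' j : ℕ, (ENNReal.ofReal ((j + 2) * (4 * D + 1)) ^ q * δ ^ j) *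
          (bmoNorm b ^ q * μ (gridCell a (2 * r) 0 0)) := by
        refine ENNReal.tsum_le_tsum fun j => ?_
        calc _ ≤ ∫⁻ _ in E j, (ENNReal.ofReal ((j + 2) * (4 * D + 1)) * bmoNorm b) ^ q ∂μ := by
              refine setLIntegral_mono measurable_const fun y hy => ?_
              gcongr
              rw [← hMb, ← ENNReal.ofReal_mul (by positivity)]
              refine ENNReal.ofReal_le_ofReal ?_
              have h1 := abs_sub_le (b y) β (avg b (ball x r))
              have h2 := hy.2.2
              calc _ ≤ (j + 1) * T + T := by linarith
                _ = _ := by rw [hT]; ring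
          _ = ENNReal.ofReal ((j + 2) * (4 * D + 1)) ^ q * bmoNorm b ^ q * μ (E j) := by
              rw [setLIntegral_const, ENNReal.mul_rpow_of_nonneg _ _ hq.le]
          _ ≤ ENNReal.ofReal ((j + 2) * (4 * D + 1)) ^ q * bmoNorm b ^ q *
                (δ ^ j * μ (gridCell a (2 * r) 0 0)) := by gcongr; exact hEμ j
          _ = _ := by ring
    _ = G * (bmoNorm b ^ q * μ (gridCell a (2 * r) 0 0)) := by rw [ENNReal.tsum_mul_right]
    _ ≤ G * (bmoNorm b ^ q * (C * ENNReal.ofReal D ^ S * μ (ball x r))) := by gcongr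
    _ = _ := by ring

theorem IsApq.exists_rpow_mul_rpow_le {p q : ℝ} {w : Rn n → ℝ} (h : IsApq p q w)
    (hp : 1 < p) (hq : 0 < q) :
    ∃ C : ℝ≥0, ∀ (x : Rn n) (r : ℝ), 0 < r →
      (∫⁻ y in ball x r, ENNReal.ofReal (w y) ^ q) ^ (1 / q) *
        (∫⁻ y in ball x r, ENNReal.ofReal (w y) ^ (-(p / (p - 1)))) ^ (1 - 1 / p) ≤
      C * volume (ball x r) ^ (1 / q + (1 - 1 / p)) := by
  obtain ⟨C, hC⟩ := h
  refine ⟨C, fun x r hr => ?_⟩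
  have hB0 : volume (ball x r) ≠ 0 := (measure_ball_pos _ _ hr).ne'
  have hBt : volume (ball x r) ≠ ∞ := measure_ball_lt_top.ne
  have hp1 : 0 ≤ 1 - 1 / p := by
    rw [sub_nonneg, div_le_one (by linarith)]; exact hp.le
  have h1 := hC x r hr
  rw [ENNReal.mul_rpow_of_nonneg _ _ (by positivity), ENNReal.mul_rpow_of_nonneg _ _ hp1,
    mul_mul_mul_comm, ← ENNReal.rpow_add_of_nonneg _ _ (by positivity) hp1, ENNReal.inv_rpow,
    mul_comm, ← div_eq_mul_inv, ENNReal.div_le_iff] at h1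
  · exact h1
  · exact (ENNReal.rpow_pos (pos_iff_ne_zero.2 hB0) hBt).ne'
  · exact ENNReal.rpow_ne_top_of_nonneg (by positivity) hBt

theorem lintegral_ofReal_rpow_neg_ne_zero {w : Rn n → ℝ} (hw : AEMeasurable w volume) {s : ℝ}
    (hs : 0 < s) (x : Rn n) {r : ℝ} (hr : 0 < r) :
    ∫⁻ y in ball x r, ENNReal.ofReal (w y) ^ (-s) ≠ 0 := by
  intro h0
  rw [lintegral_eq_zero_iff' ((hw.ennreal_ofReal.pow_const _).restrict)] at h0
  have : ∀ᵐ _ ∂(volume.restrict (ball x r)), False := by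
    filter_upwards [h0] with y hy
    rw [Pi.zero_apply, ENNReal.rpow_neg, ENNReal.inv_eq_zero] at hy
    exact ENNReal.rpow_ne_top_of_nonneg hs.le ENNReal.ofReal_ne_top hy
  rw [Filter.eventually_false_iff_eq_bot, ae_eq_bot, Measure.restrict_eq_zero] at this
  exact (measure_ball_pos volume x hr).ne' this

theorem ae_ofReal_ne_zero_of_lintegral_rpow_neg_ne_top {w : Rn n → ℝ}
    (hw : AEMeasurable w volume) {s : ℝ} (hs : 0 < s) {B : Set (Rn n)}
    (h : ∫⁻ y in B, ENNReal.ofReal (w y) ^ (-s) ≠ ∞) :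
    ∀ᵐ y ∂(volume.restrict B), ENNReal.ofReal (w y) ≠ 0 := by
  filter_upwards [ae_lt_top' ((hw.ennreal_ofReal.pow_const _).restrict) h] with y hy h0
  rw [h0, ENNReal.zero_rpow_of_neg (by linarith)] at hy
  exact lt_irrefl _ hy

theorem setLIntegral_le_of_rpow_mul {w : Rn n → ℝ} (hw : AEMeasurable w volume) {p : ℝ}
    (hp : 1 < p) {B : Set (Rn n)} (h0 : ∀ᵐ y ∂(volume.restrict B), ENNReal.ofReal (w y) ≠ 0)
    (g : Rn n → ℝ≥0∞) :
    ∫⁻ y in B, g y ≤ (∫⁻ y in B, g y ^ p * ENNReal.ofReal (w y) ^ p) ^ (1 / p) *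
      (∫⁻ y in B, ENNReal.ofReal (w y) ^ (-(p / (p - 1)))) ^ (1 - 1 / p) := by
  obtain ⟨g', hg', hle, heq⟩ := exists_measurable_le_lintegral_eq (μ := volume.restrict B) g
  have hpq : p.HolderConjugate (p / (p - 1)) := Real.HolderConjugate.conjExponent hp
  have hwv : AEMeasurable (fun y => ENNReal.ofReal (w y)) (volume.restrict B) :=
    hw.ennreal_ofReal.restrict
  have hH := ENNReal.lintegral_mul_le_Lp_mul_Lq (volume.restrict B) hpq
    (f := fun y => g' y * ENNReal.ofReal (w y)) (g := fun y => (ENNReal.ofReal (w y))⁻¹)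
    (hg'.aemeasurable.mul hwv) hwv.inv
  have he : 1 / (p / (p - 1)) = 1 - 1 / p := by
    have : p - 1 ≠ 0 := by linarith
    field_simp
  rw [heq]
  calc ∫⁻ y in B, g' y
      = ∫⁻ y in B, ((fun y => g' y * ENNReal.ofReal (w y)) *
          fun y => (ENNReal.ofReal (w y))⁻¹) y := by
        refine lintegral_congr_ae ?_
        filter_upwards [h0] with y hy
        rw [Pi.mul_apply, mul_assoc, ENNReal.mul_inv_cancel hy ENNReal.ofReal_ne_top, mul_one]
    _ ≤ _ := hH
    _ ≤ _ := by
        rw [he]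
        simp only [ENNReal.inv_rpow, ← ENNReal.rpow_neg]
        refine mul_le_mul_left (ENNReal.rpow_le_rpow (lintegral_mono fun y => ?_)
          (by positivity)) _
        rw [ENNReal.mul_rpow_of_nonneg _ _ (by linarith)]
        gcongr
        exact hle y

section Apq

variable {p q : ℝ} {w : Rn n → ℝ} {C : ℝ≥0}

theorem lintegral_rpow_ne_top_of_apq (hw : AEMeasurable w volume) (hp : 1 < p) (hq : 0 < q)
    (hC : ∀ (x : Rn n) (r : ℝ), 0 < r →
      (∫⁻ y in ball x r, ENNReal.ofReal (w y) ^ q) ^ (1 / q) *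
        (∫⁻ y in ball x r, ENNReal.ofReal (w y) ^ (-(p / (p - 1)))) ^ (1 - 1 / p) ≤
      C * volume (ball x r) ^ (1 / q + (1 - 1 / p))) (x : Rn n) (r : ℝ) :
    ∫⁻ y in ball x r, ENNReal.ofReal (w y) ^ q ≠ ∞ := by
  rcases le_or_gt r 0 with hr | hr
  · simp [ball_eq_empty.2 hr]
  have hp1 : 0 < 1 - 1 / p := by
    rw [sub_pos, div_lt_one (by linarith)]; exact hp
  intro h
  have h1 := hC x r hr
  rw [h, ENNReal.top_rpow_of_pos (by positivity), ENNReal.top_mul, top_le_iff] at h1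
  · exact ENNReal.mul_ne_top ENNReal.coe_ne_top
      (ENNReal.rpow_ne_top_of_nonneg (by positivity) measure_ball_lt_top.ne) h1
  · rw [Ne, ENNReal.rpow_eq_zero_iff_of_pos hp1]
    exact lintegral_ofReal_rpow_neg_ne_zero hw (div_pos (by linarith) (by linarith)) x hr

theorem lintegral_rpow_neg_ne_top_of_apq (hp : 1 < p) (hq : 0 < q)
    (hC : ∀ (x : Rn n) (r : ℝ), 0 < r →
      (∫⁻ y in ball x r, ENNReal.ofReal (w y) ^ q) ^ (1 / q) *
        (∫⁻ y in ball x r, ENNReal.ofReal (w y) ^ (-(p / (p - 1)))) ^ (1 - 1 / p) ≤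
      C * volume (ball x r) ^ (1 / q + (1 - 1 / p))) {x : Rn n} {r : ℝ} (hr : 0 < r)
    (h0 : ∫⁻ y in ball x r, ENNReal.ofReal (w y) ^ q ≠ 0) :
    ∫⁻ y in ball x r, ENNReal.ofReal (w y) ^ (-(p / (p - 1))) ≠ ∞ := by
  have hp1 : 0 < 1 - 1 / p := by
    rw [sub_pos, div_lt_one (by linarith)]; exact hp
  intro h
  have h1 := hC x r hr
  rw [h, ENNReal.top_rpow_of_pos hp1, ENNReal.mul_top, top_le_iff] at h1
  · exact ENNReal.mul_ne_top ENNReal.coe_ne_top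
      (ENNReal.rpow_ne_top_of_nonneg (by positivity) measure_ball_lt_top.ne) h1
  · rwa [Ne, ENNReal.rpow_eq_zero_iff_of_pos (by positivity)]

theorem volumeControlled_of_apq (hw : AEMeasurable w volume) (hp : 1 < p) (hq : 0 < q)
    (hC : ∀ (x : Rn n) (r : ℝ), 0 < r →
      (∫⁻ y in ball x r, ENNReal.ofReal (w y) ^ q) ^ (1 / q) *
        (∫⁻ y in ball x r, ENNReal.ofReal (w y) ^ (-(p / (p - 1)))) ^ (1 - 1 / p) ≤
      C * volume (ball x r) ^ (1 / q + (1 - 1 / p))) :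
    VolumeControlled (volume.withDensity fun y => ENNReal.ofReal (w y) ^ q)
      (1 + q * (1 - 1 / p)) (C ^ q) := by
  intro x r E hr hE hEB
  rw [withDensity_apply _ measurableSet_ball, withDensity_apply _ hE]
  rcases eq_or_ne (∫⁻ y in ball x r, ENNReal.ofReal (w y) ^ q) 0 with h0 | h0
  · rw [h0, mul_zero]; exact zero_le
  have hp1 : 0 < 1 - 1 / p := by
    rw [sub_pos, div_lt_one (by linarith)]; exact hp
  set S : ℝ := 1 + q * (1 - 1 / p) with hS
  have hS1 : 1 < S := by rw [hS]; nlinarith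
  have hσ := lintegral_rpow_neg_ne_top_of_apq hp hq hC hr h0
  have hw0 := ae_restrict_of_ae_restrict_of_subset hEB
    (ae_ofReal_ne_zero_of_lintegral_rpow_neg_ne_top hw (div_pos (by linarith) (by linarith)) hσ)
  have hwv : AEMeasurable (fun y => ENNReal.ofReal (w y)) (volume.restrict E) :=
    hw.ennreal_ofReal.restrict
  have hH := ENNReal.lintegral_mul_le_Lp_mul_Lq (volume.restrict E)
    (Real.HolderConjugate.conjExponent hS1)
    (f := fun y => ENNReal.ofReal (w y) ^ (q / S)) (g := fun y => ENNReal.ofReal (w y) ^ (-(q / S)))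
    (hwv.pow_const _) (hwv.pow_const _)
  have hS10 : S - 1 ≠ 0 := by linarith
  have e1 : q / S * S = q := by field_simp
  have e2 : -(q / S) * S.conjExponent = -(p / (p - 1)) := by
    have h1 : p - 1 ≠ 0 := by linarith
    have h3 : S - 1 = q * ((p - 1) / p) := by rw [hS]; field_simp; ring
    rw [Real.conjExponent, h3]
    field_simp
  have hone : volume E = ∫⁻ y in E, ((fun y => ENNReal.ofReal (w y) ^ (q / S)) *
      fun y => ENNReal.ofReal (w y) ^ (-(q / S))) y := by
    rw [← setLIntegral_one]
    refine lintegral_congr_ae ?_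
    filter_upwards [hw0] with y hy
    rw [Pi.mul_apply, ← ENNReal.rpow_add _ _ hy ENNReal.ofReal_ne_top, add_neg_cancel,
      ENNReal.rpow_zero]
  simp only [← ENNReal.rpow_mul, e1, e2] at hH
  rw [← hone] at hH
  have e3 : 1 / S.conjExponent * S = q * (1 - 1 / p) := by
    rw [Real.conjExponent]
    have : S - 1 = q * (1 - 1 / p) := by rw [hS]; ring
    rw [← this]
    field_simp
  have hES : volume E ^ S ≤ (∫⁻ y in E, ENNReal.ofReal (w y) ^ q) *
      (∫⁻ y in ball x r, ENNReal.ofReal (w y) ^ (-(p / (p - 1)))) ^ (q * (1 - 1 / p)) := by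
    refine (ENNReal.rpow_le_rpow hH (by linarith)).trans ?_
    rw [ENNReal.mul_rpow_of_nonneg _ _ (by linarith), ← ENNReal.rpow_mul, ← ENNReal.rpow_mul, e3,
      one_div_mul_cancel (by linarith), ENNReal.rpow_one]
    gcongr
  have hq2 := ENNReal.rpow_le_rpow (hC x r hr) hq.le
  rw [ENNReal.mul_rpow_of_nonneg _ _ hq.le, ENNReal.mul_rpow_of_nonneg _ _ hq.le,
    ← ENNReal.rpow_mul, ← ENNReal.rpow_mul, ← ENNReal.rpow_mul, one_div_mul_cancel hq.ne',
    ENNReal.rpow_one, add_mul, one_div_mul_cancel hq.ne', mul_comm (1 - 1 / p) q, ← hS,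
    ← ENNReal.coe_rpow_of_nonneg _ hq.le] at hq2
  calc _ ≤ (∫⁻ y in E, ENNReal.ofReal (w y) ^ q) *
        (∫⁻ y in ball x r, ENNReal.ofReal (w y) ^ (-(p / (p - 1)))) ^ (q * (1 - 1 / p)) *
        ∫⁻ y in ball x r, ENNReal.ofReal (w y) ^ q := by gcongr
    _ = (∫⁻ y in E, ENNReal.ofReal (w y) ^ q) * ((∫⁻ y in ball x r, ENNReal.ofReal (w y) ^ q) *
        (∫⁻ y in ball x r, ENNReal.ofReal (w y) ^ (-(p / (p - 1)))) ^ (q * (1 - 1 / p))) := by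
        ring
    _ ≤ (∫⁻ y in E, ENNReal.ofReal (w y) ^ q) *
        (((C ^ q : ℝ≥0) : ℝ≥0∞) * volume (ball x r) ^ S) := by gcongr
    _ = _ := by ring

theorem wMeas_rpow_ball (hw0 : ∀ x, 0 ≤ w x) (hq : 0 < q) (x : Rn n) (r : ℝ) :
    wMeas (fun z => w z ^ q) (ball x r) = ∫⁻ y in ball x r, ENNReal.ofReal (w y) ^ q := by
  unfold wMeas
  simp only [ENNReal.ofReal_rpow_of_nonneg (hw0 _) hq.le]

/-- A function in the weighted Morrey space is integrable on balls, with a quantitative bound. -/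
theorem lintegral_ball_le_morreyNorm (hw : AEMeasurable w volume) (hw0 : ∀ x, 0 ≤ w x)
    (hp : 1 < p) (hq : 0 < q)
    (hC : ∀ (x : Rn n) (r : ℝ), 0 < r →
      (∫⁻ y in ball x r, ENNReal.ofReal (w y) ^ q) ^ (1 / q) *
        (∫⁻ y in ball x r, ENNReal.ofReal (w y) ^ (-(p / (p - 1)))) ^ (1 - 1 / p) ≤
      C * volume (ball x r) ^ (1 / q + (1 - 1 / p))) {x : Rn n} {r : ℝ} (hr : 0 < r)
    (h0 : ∫⁻ y in ball x r, ENNReal.ofReal (w y) ^ q ≠ 0) (κ : ℝ) (f : Rn n → ℝ) :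
    ∫⁻ y in ball x r, ENNReal.ofReal |f y| ≤
      C * morreyNorm p κ (fun z => w z ^ p) (fun z => w z ^ q) f *
        volume (ball x r) ^ (1 / q + (1 - 1 / p)) *
        (∫⁻ y in ball x r, ENNReal.ofReal (w y) ^ q) ^ (-(1 / q - κ / p)) := by
  have ht := lintegral_rpow_ne_top_of_apq hw hp hq hC x r
  have hσ := lintegral_rpow_neg_ne_top_of_apq hp hq hC hr h0
  have hae := ae_ofReal_ne_zero_of_lintegral_rpow_neg_ne_top hw
    (div_pos (by linarith) (by linarith)) hσ
  have hH := setLIntegral_le_of_rpow_mul hw hp hae fun y => ENNReal.ofReal |f y|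
  set W := ∫⁻ y in ball x r, ENNReal.ofReal (w y) ^ q with hW
  set N := morreyNorm p κ (fun z => w z ^ p) (fun z => w z ^ q) f with hN
  set I := ∫⁻ y in ball x r, ENNReal.ofReal |f y| ^ p * ENNReal.ofReal (w y) ^ p with hI
  set σ := ∫⁻ y in ball x r, ENNReal.ofReal (w y) ^ (-(p / (p - 1)))
  have hp0 : 0 < p := by linarith
  have hIN : I ^ (1 / p) ≤ W ^ (κ / p) * N := by
    have h1 : (W ^ (-κ) * I) ^ (1 / p) ≤ N := by
      rw [hN, hW, hI, ← wMeas_rpow_ball hw0 hq]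
      simp only [ENNReal.ofReal_rpow_of_nonneg (hw0 _) hp0.le]
      unfold morreyNorm
      exact le_iSup_of_le x (le_iSup_of_le r (le_iSup_of_le hr le_rfl))
    rw [ENNReal.mul_rpow_of_nonneg _ _ (by positivity), ← ENNReal.rpow_mul] at h1
    calc I ^ (1 / p) = W ^ (κ / p) * (W ^ (-κ * (1 / p)) * I ^ (1 / p)) := by
          rw [← mul_assoc, ← ENNReal.rpow_add _ _ h0 ht]
          have : κ / p + -κ * (1 / p) = 0 := by ring
          rw [this, ENNReal.rpow_zero, one_mul]
      _ ≤ _ := by gcongr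
  have hσW : σ ^ (1 - 1 / p) ≤ W ^ (-(1 / q)) *
      (C * volume (ball x r) ^ (1 / q + (1 - 1 / p))) := by
    calc σ ^ (1 - 1 / p) = W ^ (-(1 / q)) * (W ^ (1 / q) * σ ^ (1 - 1 / p)) := by
          rw [← mul_assoc, ← ENNReal.rpow_add _ _ h0 ht, neg_add_cancel, ENNReal.rpow_zero, one_mul]
      _ ≤ _ := mul_le_mul' le_rfl (hC x r hr)
  calc _ ≤ I ^ (1 / p) * σ ^ (1 - 1 / p) := hH
    _ ≤ W ^ (κ / p) * N * (W ^ (-(1 / q)) *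
        (C * volume (ball x r) ^ (1 / q + (1 - 1 / p)))) := by gcongr
    _ = C * N * volume (ball x r) ^ (1 / q + (1 - 1 / p)) * (W ^ (κ / p) * W ^ (-(1 / q))) := by
        ring
    _ = _ := by
        rw [← ENNReal.rpow_add _ _ h0 ht]
        congr 2
        ring

end Apq

/-- Dyadic decomposition of a fractional kernel away from the diagonal. -/
theorem lintegral_compl_ball_kernel_le {α CK : ℝ} (hαn : α < n) {k f : Rn n → ℝ} {x x₀ : Rn n}
    {r : ℝ} (hr : 0 < r) (hx : x ∈ ball x₀ r)
    (hk : ∀ y, x ≠ y → |k y| ≤ CK * ‖x - y‖ ^ (α - (n : ℝ))) :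
    ∫⁻ y in (ball x₀ (2 * r))ᶜ, ENNReal.ofReal (|k y| * |f y|) ≤
      ∑' j : ℕ, ENNReal.ofReal (|CK| * (4 ^ j * r) ^ (α - (n : ℝ))) *
        ∫⁻ y in ball x₀ (8 * (4 ^ j * r)), ENNReal.ofReal |f y| := by
  set A : ℕ → Set (Rn n) := fun j => ball x₀ (8 * (4 ^ j * r)) \ ball x₀ (2 * (4 ^ j * r)) with hA
  have hcov : (ball x₀ (2 * r))ᶜ ⊆ ⋃ j, A j := by
    intro y hy
    rw [mem_compl_iff, mem_ball, not_lt] at hy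
    obtain ⟨j, h1, h2⟩ := exists_nat_pow_near (x := dist y x₀ / (2 * r)) (y := 4)
      ((one_le_div (by positivity)).2 hy) (by norm_num)
    rw [le_div_iff₀ (by positivity)] at h1
    rw [div_lt_iff₀ (by positivity), pow_succ] at h2
    refine mem_iUnion.2 ⟨j, ?_, ?_⟩
    · rw [mem_ball]; linarith
    · rw [mem_ball, not_lt]; linarith
  refine (lintegral_mono_set hcov).trans ((lintegral_iUnion_le _ _).trans
    (ENNReal.tsum_le_tsum fun j => ?_))
  have hj : 1 ≤ (4 : ℝ) ^ j := one_le_pow₀ (by norm_num)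
  have hAj : MeasurableSet (A j) := measurableSet_ball.diff measurableSet_ball
  calc ∫⁻ y in A j, ENNReal.ofReal (|k y| * |f y|)
      ≤ ∫⁻ y in A j, ENNReal.ofReal (|CK| * (4 ^ j * r) ^ (α - (n : ℝ))) *
          ENNReal.ofReal |f y| := by
        refine setLIntegral_mono' hAj fun y hy => ?_
        have hd : 4 ^ j * r ≤ ‖x - y‖ := by
          have h1 : 2 * (4 ^ j * r) ≤ dist y x₀ := not_lt.1 hy.2
          have h2 : dist x x₀ < r := hx
          have h3 := dist_triangle_left y x₀ x
          rw [← dist_eq_norm]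
          nlinarith
        have hne : x ≠ y := by
          rintro rfl
          rw [sub_self, norm_zero] at hd
          nlinarith
        rw [← ENNReal.ofReal_mul (by positivity)]
        refine ENNReal.ofReal_le_ofReal (mul_le_mul_of_nonneg_right ?_ (abs_nonneg _))
        refine (hk y hne).trans (mul_le_mul (le_abs_self _) ?_ (by positivity) (abs_nonneg _))
        exact Real.rpow_le_rpow_of_nonpos (by positivity) hd (by linarith)
    _ ≤ _ := by
        rw [lintegral_const_mul' _ _ ENNReal.ofReal_ne_top]
        exact mul_le_mul' le_rfl (lintegral_mono_set sdiff_subset)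

theorem volume_ball_rpow {s : ℝ} (hs : 0 ≤ s) (hn : 0 < n) (x : Rn n) {R : ℝ} (hR : 0 < R) :
    volume (ball x R) ^ (s / n) =
      ENNReal.ofReal (R ^ s) * volume (ball (0 : Rn n) 1) ^ (s / n) := by
  have hn' : (0 : ℝ) < n := by exact_mod_cast hn
  have h1 := volume_ball_mul (x := x) (y := (0 : Rn n)) (r := 1) hR
  rw [mul_one] at h1
  rw [h1, ENNReal.mul_rpow_of_nonneg _ _ (by positivity),
    ENNReal.ofReal_rpow_of_nonneg (by positivity) (by positivity), ← Real.rpow_natCast,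
    ← Real.rpow_mul hR.le, mul_div_cancel₀ _ hn'.ne']

/-- Iterating a reverse doubling inequality turns negative powers of the measures of the balls
`4 ^ j B` into a geometric sequence. -/
theorem rpow_neg_measure_ball_le {μ : Measure (Rn n)} {δ : ℝ≥0∞}
    (hδ : ∀ (x : Rn n) (r : ℝ), 0 < r → μ (ball x r) ≤ δ * μ (ball x (4 * r)))
    (hfin : ∀ x r, μ (ball x r) ≠ ∞) {θ : ℝ} (hθ : 0 < θ) {x : Rn n} {r : ℝ} (hr : 0 < r)
    (h0 : μ (ball x r) ≠ 0) (j : ℕ) :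
    μ (ball x (8 * (4 ^ j * r))) ^ (-θ) ≤ (δ ^ θ) ^ j * μ (ball x r) ^ (-θ) := by
  have hit : ∀ j : ℕ, μ (ball x r) ≤ δ ^ j * μ (ball x (4 ^ j * r)) := by
    intro j
    induction j with
    | zero => simp
    | succ j ih =>
      calc _ ≤ δ ^ j * μ (ball x (4 ^ j * r)) := ih
        _ ≤ δ ^ j * (δ * μ (ball x (4 * (4 ^ j * r)))) :=
          mul_le_mul' le_rfl (hδ _ _ (by positivity))
        _ = _ := by rw [pow_succ, mul_assoc, pow_succ', mul_assoc]
  have hle : μ (ball x r) ≤ δ ^ j * μ (ball x (8 * (4 ^ j * r))) := by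
    refine (hit j).trans (mul_le_mul' le_rfl (measure_mono (ball_subset_ball ?_)))
    have : 0 < 4 ^ j * r := by positivity
    linarith
  have hB0 : μ (ball x (8 * (4 ^ j * r))) ≠ 0 := by
    intro h
    rw [h, mul_zero] at hle
    exact h0 (le_antisymm hle zero_le)
  have hBt := hfin x (8 * (4 ^ j * r))
  have hrt := hfin x r
  have hle' := ENNReal.rpow_le_rpow hle hθ.le
  rw [ENNReal.mul_rpow_of_nonneg _ _ hθ.le, ← ENNReal.rpow_natCast, ← ENNReal.rpow_mul,
    mul_comm (j : ℝ), ENNReal.rpow_mul, ENNReal.rpow_natCast] at hle'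
  calc μ (ball x (8 * (4 ^ j * r))) ^ (-θ)
      = μ (ball x (8 * (4 ^ j * r))) ^ (-θ) * μ (ball x r) ^ θ * μ (ball x r) ^ (-θ) := by
        rw [mul_assoc, ← ENNReal.rpow_add _ _ h0 hrt, add_neg_cancel, ENNReal.rpow_zero, mul_one]
    _ ≤ μ (ball x (8 * (4 ^ j * r))) ^ (-θ) *
        ((δ ^ θ) ^ j * μ (ball x (8 * (4 ^ j * r))) ^ θ) * μ (ball x r) ^ (-θ) := by
        gcongr
    _ = (δ ^ θ) ^ j * (μ (ball x (8 * (4 ^ j * r))) ^ (-θ) *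
          μ (ball x (8 * (4 ^ j * r))) ^ θ) * μ (ball x r) ^ (-θ) := by ring
    _ = _ := by
        rw [← ENNReal.rpow_add _ _ hB0 hBt, neg_add_cancel, ENNReal.rpow_zero, mul_one]

/-- the estimate (3.7) for the term I: with
`H(x) = |b(x)-b_B| ∫_{ℝⁿ∖2B} |K(x,y)| |f(y)| dy`, one has
`w^q(B)^{-κ/p} (∫_B H^q w^q)^{1/q} ≤ C ‖b‖_* ‖f‖_{L^{p,κ}(w^p,w^q)}`. -/
theorem stmt15 (n : ℕ) (α p q κ CK : ℝ) (w : Rn n → ℝ) (K : Rn n → Rn n → ℝ)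
    (b : Rn n → ℝ)
    (hα : 0 < α) (hαn : α < n) (hp : 1 < p) (hpn : p < n / α)
    (hq : 1 / q = 1 / p - α / n) (hκ : 0 < κ) (hκ' : κ < p / q)
    (hw : IsWeight w) (hApq : IsApq p q w)
    (hKm : Measurable (Function.uncurry K))
    (hK : ∀ x y : Rn n, x ≠ y → |K x y| ≤ CK * ‖x - y‖ ^ (α - (n : ℝ)))
    (hb : IsBMO b) :
    ∃ C : ℝ≥0, ∀ (f : Rn n → ℝ) (x₀ : Rn n) (r : ℝ), 0 < r →
      (wMeas (fun z => w z ^ q) (ball x₀ r)) ^ (-(κ / p)) *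
        (∫⁻ x in ball x₀ r,
          (ENNReal.ofReal |b x - avg b (ball x₀ r)| *
              ∫⁻ y in (ball x₀ (2 * r))ᶜ, ENNReal.ofReal (|K x y| * |f y|)) ^ q *
            ENNReal.ofReal (w x ^ q)) ^ (1 / q) ≤
        (C : ℝ≥0∞) * bmoNorm b *
          morreyNorm p κ (fun z => w z ^ p) (fun z => w z ^ q) f := by
  have hn0 : (0 : ℝ) < n := hα.trans hαn
  have hn : 0 < n := by exact_mod_cast hn0
  have : NeZero n := ⟨hn.ne'⟩
  have hp0 : 0 < p := by linarith
  have hq0 : 0 < q := by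
    have h1 : p * α < n := (lt_div_iff₀ hα).1 hpn
    have h2 : α / n < 1 / p := by
      rw [div_lt_div_iff₀ hn0 hp0]; linarith
    have h3 : 0 < 1 / q := by rw [hq]; linarith
    exact one_div_pos.1 h3
  have hwm : AEMeasurable w volume := hw.2.aestronglyMeasurable.aemeasurable
  obtain ⟨C₀, hC⟩ := hApq.exists_rpow_mul_rpow_le hp hq0
  set v : Rn n → ℝ≥0∞ := fun y => ENNReal.ofReal (w y) ^ q with hv
  have hvm : AEMeasurable v volume := hwm.ennreal_ofReal.pow_const _
  set μ : Measure (Rn n) := volume.withDensity v with hμ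
  have hμB : ∀ x r, μ (ball x r) = ∫⁻ y in ball x r, v y := fun x r =>
    withDensity_apply _ measurableSet_ball
  have hfin : ∀ x r, μ (ball x r) ≠ ∞ := fun x r => by
    rw [hμB]; exact lintegral_rpow_ne_top_of_apq hwm hp hq0 hC x r
  have hS : 0 ≤ 1 + q * (1 - 1 / p) := by
    have : 0 ≤ 1 - 1 / p := by rw [sub_nonneg, div_le_one hp0]; exact hp.le
    positivity
  have hVC := volumeControlled_of_apq hwm hp hq0 hC
  obtain ⟨δ, hδ1, hδ⟩ := hVC.exists_ball_ratio hS hfin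
  obtain ⟨C', hC't, hC'⟩ := hVC.exists_lintegral_sub_avg_rpow_le hS hfin
    (withDensity_absolutelyContinuous _ _) hq0
  set θ : ℝ := 1 / q - κ / p with hθ
  have hθ0 : 0 < θ := by
    rw [hθ, sub_pos, div_lt_div_iff₀ hp0 hq0]
    rw [lt_div_iff₀ hq0] at hκ'
    linarith
  have he : 1 / q + (1 - 1 / p) = ((n : ℝ) - α) / n := by
    rw [hq, sub_div, div_self hn0.ne']; ring
  set C₁ : ℝ≥0∞ := ENNReal.ofReal (|CK| * 8 ^ ((n : ℝ) - α)) *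
    volume (ball (0 : Rn n) 1) ^ (((n : ℝ) - α) / n) * C₀ with hC₁
  set D : ℝ≥0∞ := C' ^ (1 / q) * C₁ * (1 - δ ^ θ)⁻¹ with hD
  have hDt : D ≠ ∞ := by
    have h1 : δ ^ θ < 1 := ENNReal.rpow_lt_one hδ1 hθ0
    refine ENNReal.mul_ne_top (ENNReal.mul_ne_top
      (ENNReal.rpow_ne_top_of_nonneg (by positivity) hC't) ?_)
      (ENNReal.inv_ne_top.2 (tsub_pos_of_lt h1).ne')
    refine ENNReal.mul_ne_top (ENNReal.mul_ne_top ENNReal.ofReal_ne_top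
      (ENNReal.rpow_ne_top_of_nonneg ?_ measure_ball_lt_top.ne)) ENNReal.coe_ne_top
    exact div_nonneg (by linarith) hn0.le
  refine ⟨D.toNNReal, fun f x₀ r hr => ?_⟩
  rw [ENNReal.coe_toNNReal hDt, wMeas_rpow_ball hw.1 hq0, ← hμB]
  simp only [← ENNReal.ofReal_rpow_of_nonneg (hw.1 _) hq0.le]
  set N := morreyNorm p κ (fun z => w z ^ p) (fun z => w z ^ q) f with hN
  set G : Rn n → ℝ≥0∞ := fun x => ENNReal.ofReal |b x - avg b (ball x₀ r)| with hG
  have hGm : AEMeasurable G volume := by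
    have h1 : AEMeasurable b volume := hb.1.aestronglyMeasurable.aemeasurable
    exact (continuous_abs.measurable.comp_aemeasurable (h1.sub_const _)).ennreal_ofReal
  have hLμ : ∀ g : Rn n → ℝ≥0∞, AEMeasurable g volume →
      ∫⁻ x in ball x₀ r, g x * v x = ∫⁻ x in ball x₀ r, g x ∂μ := fun g hg => by
    rw [hμ, restrict_withDensity measurableSet_ball,
      lintegral_withDensity_eq_lintegral_mul₀ hvm.restrict hg.restrict]
    simp only [Pi.mul_apply, mul_comm]
  rcases eq_or_ne (μ (ball x₀ r)) 0 with h0 | h0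
  · have hv0 : ∀ᵐ x ∂(volume.restrict (ball x₀ r)), v x = 0 := by
      rw [hμB, lintegral_eq_zero_iff' hvm.restrict] at h0
      exact h0
    rw [lintegral_congr_ae (g := fun _ => 0) (by
      filter_upwards [hv0] with x hx
      rw [show ENNReal.ofReal (w x) ^ q = 0 from hx, mul_zero]), lintegral_zero,
      ENNReal.zero_rpow_of_pos (by positivity), mul_zero]
    exact zero_le
  have hF : ∀ x ∈ ball x₀ r, ∫⁻ y in (ball x₀ (2 * r))ᶜ, ENNReal.ofReal (|K x y| * |f y|) ≤
      C₁ * (1 - δ ^ θ)⁻¹ * N * μ (ball x₀ r) ^ (-θ) := by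
    intro x hx
    refine (lintegral_compl_ball_kernel_le hαn hr hx (hK x)).trans ?_
    calc _ ≤ ∑' j : ℕ, (δ ^ θ) ^ j * (C₁ * N * μ (ball x₀ r) ^ (-θ)) := by
          refine ENNReal.tsum_le_tsum fun j => ?_
          have hρ : 0 < 4 ^ j * r := by positivity
          have hj0 : μ (ball x₀ (8 * (4 ^ j * r))) ≠ 0 := by
            refine fun h => h0 (measure_mono_null (ball_subset_ball ?_) h)
            have : 1 ≤ (4 : ℝ) ^ j := one_le_pow₀ (by norm_num)
            nlinarith
          have hM := lintegral_ball_le_morreyNorm hwm hw.1 hp hq0 hC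
            (by positivity : 0 < 8 * (4 ^ j * r)) (by rw [← hμB]; exact hj0) κ f
          rw [← hN, ← hθ, ← hμB, he, volume_ball_rpow (by linarith) hn _ (by positivity)] at hM
          have hcst : ENNReal.ofReal (|CK| * (4 ^ j * r) ^ (α - (n : ℝ))) *
              ENNReal.ofReal ((8 * (4 ^ j * r)) ^ ((n : ℝ) - α)) =
              ENNReal.ofReal (|CK| * 8 ^ ((n : ℝ) - α)) := by
            rw [← ENNReal.ofReal_mul (by positivity), Real.mul_rpow (by norm_num) hρ.le]
            have h1 : (4 ^ j * r) ^ (α - (n : ℝ)) * (4 ^ j * r) ^ ((n : ℝ) - α) = 1 := by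
              rw [← Real.rpow_add hρ]; simp
            congr 1
            linear_combination |CK| * 8 ^ ((n : ℝ) - α) * h1
          have hR := rpow_neg_measure_ball_le hδ hfin hθ0 hr h0 j
          refine (mul_le_mul' le_rfl (hM.trans (mul_le_mul' le_rfl hR))).trans_eq ?_
          rw [hC₁, ← hcst]
          ring
      _ = _ := by
          rw [ENNReal.tsum_mul_right, ENNReal.tsum_geometric]
          ring
  set F := C₁ * (1 - δ ^ θ)⁻¹ * N * μ (ball x₀ r) ^ (-θ) with hFdef
  have hI : ∫⁻ x in ball x₀ r, (G x * ∫⁻ y in (ball x₀ (2 * r))ᶜ,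
      ENNReal.ofReal (|K x y| * |f y|)) ^ q * ENNReal.ofReal (w x) ^ q ≤
      F ^ q * (C' * bmoNorm b ^ q * μ (ball x₀ r)) := by
    calc _ ≤ ∫⁻ x in ball x₀ r, F ^ q * (G x ^ q * v x) := by
          refine setLIntegral_mono' measurableSet_ball fun x hx => ?_
          rw [← mul_assoc, ← ENNReal.mul_rpow_of_nonneg F _ hq0.le, mul_comm F]
          exact mul_le_mul' (ENNReal.rpow_le_rpow (mul_le_mul' le_rfl (hF x hx)) hq0.le) le_rfl
      _ = F ^ q * ∫⁻ x in ball x₀ r, G x ^ q ∂μ := by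
          rw [lintegral_const_mul'' (f := fun x => G x ^ q * v x) _
            ((hGm.pow_const _).mul hvm).restrict, hLμ _ (hGm.pow_const _)]
      _ ≤ _ := mul_le_mul' le_rfl (hC' b hb x₀ r hr)
  have h1q : 0 ≤ 1 / q := by positivity
  calc _ ≤ μ (ball x₀ r) ^ (-(κ / p)) *
        (F ^ q * (C' * bmoNorm b ^ q * μ (ball x₀ r))) ^ (1 / q) :=
        mul_le_mul' le_rfl (ENNReal.rpow_le_rpow hI h1q)
    _ = D * bmoNorm b * N * (μ (ball x₀ r) ^ (-(κ / p)) * μ (ball x₀ r) ^ (1 / q) *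
        μ (ball x₀ r) ^ (-θ)) := by
        rw [ENNReal.mul_rpow_of_nonneg _ _ h1q, ENNReal.mul_rpow_of_nonneg _ _ h1q,
          ENNReal.mul_rpow_of_nonneg _ _ h1q, ← ENNReal.rpow_mul, ← ENNReal.rpow_mul,
          mul_one_div_cancel hq0.ne', ENNReal.rpow_one, ENNReal.rpow_one, hFdef, hD]
        ring
    _ = _ := by
        rw [← ENNReal.rpow_add _ _ h0 (hfin _ _), ← ENNReal.rpow_add _ _ h0 (hfin _ _), hθ]
        ring_nf
        simp
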